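/- arXiv:1210.1735 — 8 statements merged into one kernel-verified Lean document; each statement's English description precedes it below -/
import Mathlib

section
/- Let n ≥ 1 and let A be a real n×n matrix with zero diagonal (a_{ii} = 0 for all i). Then A is a Kleene star (i.e., A = A⊙A where ⊙ denotes tropical matrix multiplication) if and only if C_A = span(A) ∩ {x ∈ ℝ^n : x_n = 0}. -/
open Finset

/-- Tropical (max-plus) product of square real matrices: (A⊙B) i j = max_k (A i k + B k j). -/
def tmul {n : ℕ} (A B : Matrix (Fin (n+1)) (Fin (n+1)) ℝ) :
    Matrix (Fin (n+1)) (Fin (n+1)) ℝ :=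
  fun i j => univ.sup' univ_nonempty (fun k => A i k + B k j)

/-- Tropical column span of A: points x with x i = max_k (λ k + A i k) for some reals λ k. -/
def tspan {n : ℕ} (A : Matrix (Fin (n+1)) (Fin (n+1)) ℝ) : Set (Fin (n+1) → ℝ) :=
  { x | ∃ lam : Fin (n+1) → ℝ,
      ∀ i, x i = univ.sup' univ_nonempty (fun k => lam k + A i k) }

/-- The alcoved polytope C_A induced by a (zero-diagonal) matrix A, viewed inside
the hyperplane {x : x (last) = 0}. -/
def CA {n : ℕ} (A : Matrix (Fin (n+1)) (Fin (n+1)) ℝ) : Set (Fin (n+1) → ℝ) :=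
  { x | x (Fin.last n) = 0 ∧
      (∀ i, i ≠ Fin.last n → A i (Fin.last n) ≤ x i ∧ x i ≤ - A (Fin.last n) i) ∧
      (∀ i k, i ≠ Fin.last n → k ≠ Fin.last n → i ≠ k →
        A i k ≤ x i - x k ∧ x i - x k ≤ - A k i) }

/-- A zero-diagonal matrix is a Kleene star iff it satisfies the triangle inequality. -/
theorem eq_tmul_self_iff {n : ℕ} {A : Matrix (Fin (n+1)) (Fin (n+1)) ℝ}
    (hdiag : ∀ i, A i i = 0) :
    A = tmul A A ↔ ∀ i k j, A i k + A k j ≤ A i j := by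
  constructor
  · intro h i k j
    have hij : A i j = univ.sup' univ_nonempty (fun k => A i k + A k j) := congrFun₂ h i j
    rw [hij]
    exact le_sup' (fun k => A i k + A k j) (mem_univ k)
  · intro h
    ext i j
    refine le_antisymm ?_ (sup'_le _ _ fun k _ => h i k j)
    have hi := le_sup' (fun k => A i k + A k j) (mem_univ i)
    rw [hdiag, zero_add] at hi
    exact hi

/-- For a zero-diagonal matrix, the inequalities defining `CA` can be written uniformly. -/
theorem mem_CA_iff {n : ℕ} {A : Matrix (Fin (n+1)) (Fin (n+1)) ℝ}
    (hdiag : ∀ i, A i i = 0) {x : Fin (n+1) → ℝ} :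
    x ∈ CA A ↔ x (Fin.last n) = 0 ∧ ∀ i k, A i k + x k ≤ x i := by
  constructor
  · rintro ⟨h0, h1, h2⟩
    refine ⟨h0, fun i k => ?_⟩
    by_cases hik : i = k
    · subst hik
      simp [hdiag]
    by_cases hi : i = Fin.last n
    · subst hi
      linarith [(h1 k (Ne.symm hik)).2]
    by_cases hk : k = Fin.last n
    · subst hk
      linarith [(h1 i hi).1]
    linarith [(h2 i k hi hk hik).1]
  · rintro ⟨h0, h⟩
    refine ⟨h0, fun i _ => ⟨?_, ?_⟩, fun i k _ _ _ => ⟨?_, ?_⟩⟩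
    · linarith [h i (Fin.last n)]
    · linarith [h (Fin.last n) i]
    · linarith [h i k]
    · linarith [h k i]

/-- Every translate of a column of `A` lies in the tropical column span of `A`. -/
theorem col_add_const_mem_tspan {n : ℕ} (A : Matrix (Fin (n+1)) (Fin (n+1)) ℝ)
    (j : Fin (n+1)) (c : ℝ) : (fun i => A i j + c) ∈ tspan A := by
  refine ⟨fun k => univ.inf' univ_nonempty (fun i => A i j - A i k) + c, fun i => ?_⟩
  refine le_antisymm ?_ (sup'_le _ _ fun k _ => ?_)
  · refine le_trans ?_ (le_sup' _ (mem_univ j))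
    simp [add_comm]
  · have hk := inf'_le (fun i => A i j - A i k) (mem_univ i)
    linarith

/-- Points satisfying all the inequalities `A i k + x k ≤ x i` lie in the tropical span. -/
theorem mem_tspan_of_forall_le {n : ℕ} {A : Matrix (Fin (n+1)) (Fin (n+1)) ℝ}
    (hdiag : ∀ i, A i i = 0) {x : Fin (n+1) → ℝ} (h : ∀ i k, A i k + x k ≤ x i) :
    x ∈ tspan A := by
  refine ⟨x, fun i => le_antisymm ?_ (sup'_le _ _ fun k _ => by linarith [h i k])⟩
  have hi := le_sup' (fun k => x k + A i k) (mem_univ i)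
  simpa only [hdiag, add_zero] using hi

/-- Under the triangle inequality, points of the tropical span satisfy `A i k + x k ≤ x i`. -/
theorem add_le_of_mem_tspan {n : ℕ} {A : Matrix (Fin (n+1)) (Fin (n+1)) ℝ}
    (hA : ∀ i k j, A i k + A k j ≤ A i j) {x : Fin (n+1) → ℝ} (hx : x ∈ tspan A)
    (i k : Fin (n+1)) : A i k + x k ≤ x i := by
  obtain ⟨lam, hlam⟩ := hx
  suffices x k ≤ x i - A i k by linarith
  rw [hlam k]
  refine sup'_le _ _ fun l _ => ?_
  have hl := le_sup' (fun l => lam l + A i l) (mem_univ l)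
  rw [← hlam i] at hl
  linarith [hA i k l]

/-- A zero-diagonal real square matrix (size n+1, i.e. n ≥ 1 columns/rows ≥ 1)
is a Kleene star iff C_A equals the section of its tropical span by the
hyperplane {x_n = 0}. -/
theorem kleene_star_iff_section (n : ℕ) (A : Matrix (Fin (n+1)) (Fin (n+1)) ℝ)
    (hdiag : ∀ i, A i i = 0) :
    A = tmul A A ↔ CA A = tspan A ∩ {x | x (Fin.last n) = 0} := by
  rw [eq_tmul_self_iff hdiag]
  constructor
  · intro hA
    ext x
    rw [mem_CA_iff hdiag]
    exact ⟨fun h => ⟨mem_tspan_of_forall_le hdiag h.2, h.1⟩,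
      fun h => ⟨h.2, add_le_of_mem_tspan hA h.1⟩⟩
  · intro hC i k j
    have hmem : (fun i => A i j + -A (Fin.last n) j) ∈ CA A := by
      rw [hC]
      exact ⟨col_add_const_mem_tspan A j _, add_neg_cancel _⟩
    linarith [((mem_CA_iff hdiag).1 hmem).2 i k]
end

section
/- Let A be a real n×n matrix with zero diagonal. Then C_A ⊆ span(A) ∩ {x ∈ ℝ^n : x_n = 0}. -/
open Finset

/-- For any zero-diagonal real square matrix A, C_A is contained in
span(A) ∩ {x_n = 0}. -/
theorem CA_subset_span_section (n : ℕ) (A : Matrix (Fin (n+1)) (Fin (n+1)) ℝ)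
    (hdiag : ∀ i, A i i = 0) :
    CA A ⊆ tspan A ∩ {x | x (Fin.last n) = 0} := by
  rintro x ⟨hlast, hbound, hdiff⟩
  have hle : ∀ i k, x k + A i k ≤ x i := by
    intro i k
    rcases eq_or_ne i k with rfl | hik
    · simp [hdiag]
    rcases eq_or_ne k (Fin.last n) with rfl | hk
    · linarith [(hbound i hik).1]
    rcases eq_or_ne i (Fin.last n) with rfl | hi
    · linarith [(hbound k hk).2]
    · linarith [(hdiff i k hi hk hik).1]
  refine ⟨⟨x, fun i => le_antisymm ?_ (sup'_le _ _ fun k _ => hle i k)⟩, hlast⟩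
  exact (le_sup'_iff _).2 ⟨i, mem_univ i, by simp [hdiag]⟩
end

section
/- Let A be a real n×n matrix with zero diagonal and let x, y ∈ C_A. Then every point z of the tropical segment joining x and y that satisfies z_n = 0 belongs to C_A. Explicitly: if λ, μ ∈ ℝ with max(λ, μ) = 0 and z_i = max(λ + x_i, μ + y_i) for all i ∈ [n], then z ∈ C_A. (Tropical convexity of C_A.) -/
open Finset

/-- A common lower bound for the difference of two coordinates passes to tropical combinations. -/
theorem le_max_add_sub_max_add {a p q r s : ℝ} (lam mu : ℝ) (hp : a ≤ p - q) (hr : a ≤ r - s) :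
    a ≤ max (lam + p) (mu + r) - max (lam + q) (mu + s) := by
  have h : max (lam + q) (mu + s) ≤ max (lam + p) (mu + r) - a :=
    max_le (by linarith [le_max_left (lam + p) (mu + r)])
      (by linarith [le_max_right (lam + p) (mu + r)])
  linarith

/-- Tropical convexity of C_A: any point of the tropical segment joining two
points of C_A which lies in the hyperplane {x_n = 0} belongs to C_A. -/
theorem CA_tropically_convex (n : ℕ) (A : Matrix (Fin (n+1)) (Fin (n+1)) ℝ)
    (hdiag : ∀ i, A i i = 0)
    (x y : Fin (n+1) → ℝ) (hx : x ∈ CA A) (hy : y ∈ CA A)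
    (lam mu : ℝ) (hlm : max lam mu = 0)
    (z : Fin (n+1) → ℝ) (hz : ∀ i, z i = max (lam + x i) (mu + y i)) :
    z ∈ CA A := by
  obtain ⟨hx0, hxn, hxd⟩ := hx
  obtain ⟨hy0, hyn, hyd⟩ := hy
  have hz0 : z (Fin.last n) = 0 := by rw [hz, hx0, hy0, add_zero, add_zero, hlm]
  have key : ∀ {i k a}, a ≤ x i - x k → a ≤ y i - y k → a ≤ z i - z k := fun h₁ h₂ => by
    rw [hz, hz]
    exact le_max_add_sub_max_add lam mu h₁ h₂
  refine ⟨hz0, fun i hi => ⟨?_, ?_⟩, fun i k hi hk hik => ⟨?_, ?_⟩⟩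
  · have := key (i := i) (k := Fin.last n) (a := A i (Fin.last n))
      (by linarith [(hxn i hi).1]) (by linarith [(hyn i hi).1])
    linarith
  · have := key (i := Fin.last n) (k := i) (a := A (Fin.last n) i)
      (by linarith [(hxn i hi).2]) (by linarith [(hyn i hi).2])
    linarith
  · exact key (hxd i k hi hk hik).1 (hyd i k hi hk hik).1
  · have := key (hxd k i hk hi hik.symm).1 (hyd k i hk hi hik.symm).1
    linarith
end

section
/- Let A be a real n×n matrix with zero diagonal. Then A is a Kleene star (A = A⊙A) if and only if every column of the matrix A_0 belongs to C_A, where A_0 is defined by (A_0)_{ij} = a_{ij} - a_{nj}. -/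
open Finset

/-- A zero-diagonal real square matrix A is a Kleene star iff every column of
A₀ (where (A₀) i j = A i j - A n j) belongs to C_A. -/
theorem kleene_star_iff_columns_in_CA (n : ℕ) (A : Matrix (Fin (n+1)) (Fin (n+1)) ℝ)
    (hdiag : ∀ i, A i i = 0) :
    A = tmul A A ↔
      ∀ j : Fin (n+1), (fun i => A i j - A (Fin.last n) j) ∈ CA A := by
  rw [eq_tmul_self_iff hdiag]
  constructor
  · intro h j
    refine ⟨sub_self _, fun i _ => ⟨?_, ?_⟩, fun i k _ _ _ => ⟨?_, ?_⟩⟩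
    · linarith [h i (Fin.last n) j]
    · linarith [h (Fin.last n) i j]
    · linarith [h i k j]
    · linarith [h k i j]
  · intro h i k j
    obtain ⟨-, hlast, hdiff⟩ := h j
    by_cases hik : i = k
    · subst hik
      simp [hdiag]
    by_cases hi : i = Fin.last n
    · subst hi
      linarith [(hlast k (Ne.symm hik)).2]
    by_cases hk : k = Fin.last n
    · subst hk
      linarith [(hlast i hi).1]
    linarith [(hdiff i k hi hk hik).1]
end

section
/- Let A be a real n×n matrix with zero diagonal. Then A is a Kleene star (A = A⊙A) if and only if span(A) = { y ∈ ℝ^n : ∃ x ∈ C_A, ∃ λ ∈ ℝ, y = x + (λ,…,λ) }, i.e., span(A) equals the Minkowski sum of C_A and the line spanned by the all-ones vector. -/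
open Finset

/-- The cylinder over `CA A` is cut out by the inequalities `A i k + y k ≤ y i`. -/
theorem mem_cylinder_iff {n : ℕ} {A : Matrix (Fin (n+1)) (Fin (n+1)) ℝ}
    (hdiag : ∀ i, A i i = 0) (y : Fin (n+1) → ℝ) :
    (∃ x ∈ CA A, ∃ c : ℝ, y = fun i => x i + c) ↔ ∀ i k, A i k + y k ≤ y i := by
  constructor
  · rintro ⟨x, ⟨h0, h1, h2⟩, c, rfl⟩ i k
    dsimp only
    by_cases hik : i = k
    · subst hik
      linarith [hdiag i]
    by_cases hi : i = Fin.last n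
    · subst hi
      linarith [(h1 k (Ne.symm hik)).2]
    by_cases hk : k = Fin.last n
    · subst hk
      linarith [(h1 i hi).1]
    linarith [(h2 i k hi hk hik).1]
  · intro h
    refine ⟨fun i => y i - y (Fin.last n), ⟨sub_self _, fun i _ => ?_, fun i k _ _ _ => ?_⟩,
      y (Fin.last n), by simp⟩
    · constructor <;> linarith [h i (Fin.last n), h (Fin.last n) i]
    · constructor <;> linarith [h i k, h k i]

/-- Every column of `A` lies in its tropical column span. -/
theorem column_mem_tspan {n : ℕ} (A : Matrix (Fin (n+1)) (Fin (n+1)) ℝ) (j : Fin (n+1)) :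
    (fun i => A i j) ∈ tspan A := by
  refine ⟨fun k => univ.inf' univ_nonempty fun i => A i j - A i k, fun i => le_antisymm ?_ ?_⟩
  · refine le_sup'_of_le _ (mem_univ j) ?_
    simp
  · refine sup'_le _ _ fun k _ => ?_
    linarith [inf'_le (fun i => A i j - A i k) (mem_univ i)]

/-- A zero-diagonal real square matrix A is a Kleene star iff span(A) is the
Minkowski sum of C_A and the line spanned by the all-ones vector. -/
theorem kleene_star_iff_span_eq_cylinder (n : ℕ) (A : Matrix (Fin (n+1)) (Fin (n+1)) ℝ)
    (hdiag : ∀ i, A i i = 0) :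
    A = tmul A A ↔
      tspan A = { y | ∃ x ∈ CA A, ∃ c : ℝ, y = fun i => x i + c } := by
  simp only [mem_cylinder_iff hdiag]
  rw [eq_tmul_self_iff hdiag]
  constructor
  · intro h
    ext y
    constructor
    · rintro ⟨lam, hlam⟩ i k
      rw [← le_sub_iff_add_le', hlam k]
      refine sup'_le _ _ fun l _ => ?_
      have hl := le_sup' (fun k => lam k + A i k) (mem_univ l)
      rw [← hlam i] at hl
      linarith [h i k l]
    · intro hy
      refine ⟨y, fun i => le_antisymm ?_ (sup'_le _ _ fun k _ => ?_)⟩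
      · exact le_sup'_of_le _ (mem_univ i) (by simp [hdiag])
      · linarith [hy i k]
  · intro h i k j
    have hj := column_mem_tspan A j
    rw [h] at hj
    exact hj i k
end

section
/- Let A be a normal real n×n matrix (zero diagonal and all entries ≤ 0) with n ≥ 2. Then the (n-1)-st tropical power of A is idempotent: A^{n-1} = A^n = A^{n-1} ⊙ A^{n-1}. In particular, A^{n-1} is a Kleene star. (Yoeli's theorem.) -/
open Finset

/-- Tropical power A^k (for k ≥ 1; `tpow A 0` is set to A by convention, unused). -/
def tpow {n : ℕ} (A : Matrix (Fin (n+1)) (Fin (n+1)) ℝ) :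
    ℕ → Matrix (Fin (n+1)) (Fin (n+1)) ℝ
  | 0 => A
  | 1 => A
  | (k+2) => tmul A (tpow A (k+1))

theorem add_le_tmul {n : ℕ} (A B : Matrix (Fin (n+1)) (Fin (n+1)) ℝ) (i k j : Fin (n+1)) :
    A i k + B k j ≤ tmul A B i j :=
  le_sup' (fun k => A i k + B k j) (mem_univ k)

theorem exists_tmul_eq {n : ℕ} (A B : Matrix (Fin (n+1)) (Fin (n+1)) ℝ) (i j : Fin (n+1)) :
    ∃ k, tmul A B i j = A i k + B k j := by
  obtain ⟨k, -, hk⟩ := exists_mem_eq_sup' (univ_nonempty (α := Fin (n+1)))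
    (fun k => A i k + B k j)
  exact ⟨k, hk⟩

theorem tpow_le_tpow_succ {n : ℕ} {A : Matrix (Fin (n+1)) (Fin (n+1)) ℝ}
    (hdiag : ∀ i, A i i = 0) (k : ℕ) (i j : Fin (n+1)) :
    tpow A (k+1) i j ≤ tpow A (k+2) i j := by
  have h := add_le_tmul A (tpow A (k+1)) i i j
  rwa [hdiag, zero_add] at h

theorem tpow_diag_nonneg {n : ℕ} {A : Matrix (Fin (n+1)) (Fin (n+1)) ℝ}
    (hdiag : ∀ i, A i i = 0) (k : ℕ) (i : Fin (n+1)) : 0 ≤ tpow A (k+1) i i := by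
  induction k with
  | zero => exact (hdiag i).ge
  | succ k ih => exact ih.trans (tpow_le_tpow_succ hdiag k i i)

/-- If an entry in column `j` strictly increases from the `(k+1)`-st to the `(k+2)`-nd power, then
at least `k+3` entries of that column of the latter are at least as large: they include the
vertices of an optimal walk, which cannot repeat a vertex. -/
theorem le_card_of_tpow_lt_tpow_succ {n : ℕ} {A : Matrix (Fin (n+1)) (Fin (n+1)) ℝ}
    (hdiag : ∀ i, A i i = 0) (hneg : ∀ i j, A i j ≤ 0) (j : Fin (n+1)) (k : ℕ) (i : Fin (n+1))
    (h : tpow A (k+1) i j < tpow A (k+2) i j) :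
    k + 3 ≤ #{v | tpow A (k+2) i j ≤ tpow A (k+2) v j} := by
  induction k generalizing i with
  | zero =>
    obtain ⟨l, hl⟩ : ∃ l, tpow A 2 i j = A i l + A l j := exists_tmul_eq A A i j
    change A i j < tpow A 2 i j at h
    have hil := hneg i l
    have hlj := hneg l j
    have hl_mono : A l j ≤ tpow A 2 l j := tpow_le_tpow_succ hdiag 0 l j
    have hj_nonneg : 0 ≤ tpow A 2 j j := tpow_diag_nonneg hdiag 1 j
    have i_ne_l : i ≠ l := by
      rintro rfl
      linarith
    have i_ne_j : i ≠ j := by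
      rintro rfl
      linarith [hdiag i]
    have l_ne_j : l ≠ j := by
      rintro rfl
      linarith
    calc 0 + 3 = #{i, l, j} := (card_eq_three.2 ⟨i, l, j, i_ne_l, i_ne_j, l_ne_j, rfl⟩).symm
      _ ≤ _ := card_le_card fun v hv => by
        simp only [mem_insert, mem_singleton] at hv
        simp only [mem_filter, mem_univ, true_and, zero_add]
        rcases hv with rfl | rfl | rfl <;> linarith
  | succ k ih =>
    obtain ⟨l, hl⟩ : ∃ l, tpow A (k+3) i j = A i l + tpow A (k+2) l j :=
      exists_tmul_eq A (tpow A (k+2)) i j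
    change tpow A (k+2) i j < tpow A (k+3) i j at h
    have hil := hneg i l
    have hlt : tpow A (k+1) l j < tpow A (k+2) l j := by
      have : A i l + tpow A (k+1) l j ≤ tpow A (k+2) i j := add_le_tmul A (tpow A (k+1)) i l j
      linarith
    have hi : i ∉ ({v | tpow A (k+2) l j ≤ tpow A (k+2) v j} : Finset (Fin (n+1))) := by
      simp only [mem_filter, mem_univ, true_and, not_le]
      linarith
    calc k + 1 + 3 ≤ #(insert i ({v | tpow A (k+2) l j ≤ tpow A (k+2) v j} : Finset (Fin (n+1)))) := by
          rw [card_insert_of_notMem hi]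
          linarith [ih l hlt]
      _ ≤ _ := card_le_card fun v hv => by
        simp only [mem_insert, mem_filter, mem_univ, true_and] at hv ⊢
        rcases hv with rfl | hv
        · exact le_rfl
        · have := tpow_le_tpow_succ hdiag (k+1) v j
          change tpow A (k+3) i j ≤ tpow A (k+3) v j
          change tpow A (k+2) v j ≤ tpow A (k+3) v j at this
          linarith

theorem tpow_add_le_of_tmul_eq {n : ℕ} {A B : Matrix (Fin (n+1)) (Fin (n+1)) ℝ}
    (hB : tmul A B = B) (k : ℕ) (i l j : Fin (n+1)) :
    tpow A (k+1) i l + B l j ≤ B i j := by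
  have hAB (i m : Fin (n+1)) : A i m + B m j ≤ B i j :=
    (add_le_tmul A B i m j).trans_eq (by rw [hB])
  induction k generalizing i with
  | zero => exact hAB i l
  | succ k ih =>
    obtain ⟨m, hm⟩ : ∃ m, tpow A (k+2) i l = A i m + tpow A (k+1) m l :=
      exists_tmul_eq A (tpow A (k+1)) i l
    linarith [ih m, hAB i m]

/-- Yoeli's theorem: for a normal matrix of size m = n+2 (so m ≥ 2), the
(m-1)-st tropical power is stable and idempotent, hence a Kleene star. -/
theorem yoeli (n : ℕ) (A : Matrix (Fin (n+2)) (Fin (n+2)) ℝ)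
    (hdiag : ∀ i, A i i = 0) (hneg : ∀ i j, A i j ≤ 0) :
    tpow A (n+1) = tpow A (n+2) ∧
      tpow A (n+1) = tmul (tpow A (n+1)) (tpow A (n+1)) := by
  have hstab : tpow A (n+1) = tpow A (n+2) := by
    ext i j
    refine le_antisymm (tpow_le_tpow_succ hdiag n i j) (not_lt.1 fun h => ?_)
    have hcard := (le_card_of_tpow_lt_tpow_succ hdiag hneg j n i h).trans (card_le_univ _)
    rw [Fintype.card_fin] at hcard
    omega
  refine ⟨hstab, ?_⟩
  ext i j
  apply le_antisymm
  · linarith [add_le_tmul (tpow A (n+1)) (tpow A (n+1)) i i j, tpow_diag_nonneg hdiag n i]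
  · obtain ⟨l, hl⟩ := exists_tmul_eq (tpow A (n+1)) (tpow A (n+1)) i j
    exact hl.trans_le (tpow_add_le_of_tmul_eq hstab.symm n i l j)
end

section
/- Let A be a normal real n×n matrix (zero diagonal and all entries ≤ 0). Then |||A||| = r(span(A) ∩ {x ∈ ℝ^n : x_n = 0}), i.e., the norm of A equals the tropical radius of the hyperplane section of its tropical column span: sup { ||x|| : x ∈ span(A), x_n = 0 } = max_{i,j∈[n]} |a_{ij}|. -/
open Finset

/-- Seminorm ‖p‖ = max_{i,j} max (|p i|, |p i - p j|). -/
def pnorm {n : ℕ} (p : Fin (n+1) → ℝ) : ℝ :=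
  univ.sup' univ_nonempty
    (fun ij : Fin (n+1) × Fin (n+1) => max |p ij.1| |p ij.1 - p ij.2|)

/-- Matrix norm |||A||| = max_{i,j} |A i j|. -/
def mnorm {n : ℕ} (A : Matrix (Fin (n+1)) (Fin (n+1)) ℝ) : ℝ :=
  univ.sup' univ_nonempty (fun ij : Fin (n+1) × Fin (n+1) => |A ij.1 ij.2|)

theorem abs_le_mnorm {n : ℕ} (A : Matrix (Fin (n+1)) (Fin (n+1)) ℝ) (i j : Fin (n+1)) :
    |A i j| ≤ mnorm A :=
  le_sup' (fun ij : Fin (n+1) × Fin (n+1) => |A ij.1 ij.2|) (mem_univ (i, j))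

theorem abs_sub_le_pnorm {n : ℕ} (x : Fin (n+1) → ℝ) (i j : Fin (n+1)) :
    |x i - x j| ≤ pnorm x :=
  (le_max_right _ _).trans
    (le_sup' (fun ij : Fin (n+1) × Fin (n+1) => max |x ij.1| |x ij.1 - x ij.2|)
      (mem_univ (i, j)))

/-- Coordinate differences on the tropical span of a nonpositive matrix are bounded by its norm. -/
theorem sub_le_mnorm_of_mem_tspan {n : ℕ} {A : Matrix (Fin (n+1)) (Fin (n+1)) ℝ}
    (hneg : ∀ i j, A i j ≤ 0) {x : Fin (n+1) → ℝ} (hx : x ∈ tspan A) (i j : Fin (n+1)) :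
    x i - x j ≤ mnorm A := by
  obtain ⟨lam, hlam⟩ := hx
  obtain ⟨k, -, hk⟩ := exists_mem_eq_sup' univ_nonempty (fun k => lam k + A i k)
  have hi : x i = lam k + A i k := (hlam i).trans hk
  have hj : lam k + A j k ≤ x j :=
    hlam j ▸ le_sup' (fun k => lam k + A j k) (mem_univ k)
  linarith [hneg i k, neg_abs_le (A j k), abs_le_mnorm A j k]

theorem pnorm_le_mnorm_of_mem_tspan {n : ℕ} {A : Matrix (Fin (n+1)) (Fin (n+1)) ℝ}
    (hneg : ∀ i j, A i j ≤ 0) {x : Fin (n+1) → ℝ} (hx : x ∈ tspan A)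
    (hlast : x (Fin.last n) = 0) : pnorm x ≤ mnorm A := by
  have hsub (i j : Fin (n+1)) : |x i - x j| ≤ mnorm A :=
    abs_sub_le_iff.2 ⟨sub_le_mnorm_of_mem_tspan hneg hx i j, sub_le_mnorm_of_mem_tspan hneg hx j i⟩
  refine sup'_le _ _ fun ij _ => max_le ?_ (hsub _ _)
  simpa [hlast] using hsub ij.1 (Fin.last n)

/-- Each column of a nonpositive matrix, translated so that its last entry vanishes,
lies in the tropical span. -/
theorem column_sub_last_mem_tspan {n : ℕ} {A : Matrix (Fin (n+1)) (Fin (n+1)) ℝ}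
    (hneg : ∀ i j, A i j ≤ 0) (k : Fin (n+1)) :
    (fun i => A i k - A (Fin.last n) k) ∈ tspan A := by
  refine ⟨fun j => if j = k then -A (Fin.last n) k else -mnorm A, fun i => le_antisymm ?_ ?_⟩
  · refine le_sup'_of_le _ (mem_univ k) ?_
    simp only [if_true]
    linarith
  · refine sup'_le _ _ fun j _ => ?_
    dsimp only
    split_ifs with h
    · subst h
      linarith
    · linarith [hneg i j, hneg (Fin.last n) k, neg_abs_le (A i k), abs_le_mnorm A i k]

/-- For a normal matrix A, the norm of A equals the tropical radius of the
hyperplane section of its tropical span: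
sup { ‖x‖ : x ∈ span(A), x_n = 0 } = max_{i,j} |A i j|. -/
theorem mnorm_eq_radius_span_section (n : ℕ) (A : Matrix (Fin (n+1)) (Fin (n+1)) ℝ)
    (hdiag : ∀ i, A i i = 0) (hneg : ∀ i j, A i j ≤ 0) :
    sSup { r : ℝ | ∃ x ∈ tspan A, x (Fin.last n) = 0 ∧ r = pnorm x } = mnorm A := by
  obtain ⟨⟨i, k⟩, -, hik⟩ := exists_mem_eq_sup' univ_nonempty
    (fun ij : Fin (n+1) × Fin (n+1) => |A ij.1 ij.2|)
  have hmem := column_sub_last_mem_tspan hneg k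
  have hlast : A (Fin.last n) k - A (Fin.last n) k = 0 := sub_self _
  refine IsGreatest.csSup_eq ⟨⟨_, hmem, hlast, le_antisymm ?_ ?_⟩, ?_⟩
  · have h := abs_sub_le_pnorm (fun i => A i k - A (Fin.last n) k) i k
    rw [sub_sub_sub_cancel_right, hdiag, sub_zero] at h
    exact hik.trans_le h
  · exact pnorm_le_mnorm_of_mem_tspan hneg hmem hlast
  · rintro _ ⟨x, hx, hx0, rfl⟩
    exact pnorm_le_mnorm_of_mem_tspan hneg hx hx0
end

section
/- Let p, y ∈ ℝ^n with p_n = y_n = 0, and let z = (λ + p) ⊕ (μ + y) (coordinatewise z_i = max(λ + p_i, μ + y_i)) with λ, μ ∈ ℝ and z_n = 0 = max(λ, μ). Then ||z|| ≤ max(||p||, ||y||), where ||q|| = max_{i,j∈[n]} max(|q_i|, |q_i - q_j|). -/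
open Finset

theorem sub_le_pnorm {n : ℕ} (p : Fin (n+1) → ℝ) (i j : Fin (n+1)) :
    p i - p j ≤ pnorm p :=
  (le_abs_self _).trans <| (le_max_right |p i| _).trans <|
    le_sup' (fun ij : Fin (n+1) × Fin (n+1) => max |p ij.1| |p ij.1 - p ij.2|)
      (mem_univ (i, j))

/-- For a point with a vanishing coordinate, bounding all coordinate differences
bounds the seminorm. -/
theorem pnorm_le_of_sub_le {n : ℕ} {p : Fin (n+1) → ℝ} {k : Fin (n+1)} (hk : p k = 0)
    {M : ℝ} (h : ∀ i j, p i - p j ≤ M) : pnorm p ≤ M := by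
  have habs (i j : Fin (n+1)) : |p i - p j| ≤ M :=
    abs_sub_le_iff.2 ⟨h i j, h j i⟩
  exact sup'_le _ _ fun ij _ => max_le (by simpa [hk] using habs ij.1 k) (habs ij.1 ij.2)

/-- If p, y lie in the hyperplane {x_n = 0} and z = (λ + p) ⊕ (μ + y) with
max(λ,μ) = 0 (so z_n = 0), then ‖z‖ ≤ max(‖p‖, ‖y‖). -/
theorem pnorm_trop_comb_le (n : ℕ) (p y : Fin (n+1) → ℝ)
    (hp : p (Fin.last n) = 0) (hy : y (Fin.last n) = 0)
    (lam mu : ℝ) (hlm : max lam mu = 0)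
    (z : Fin (n+1) → ℝ) (hz : ∀ i, z i = max (lam + p i) (mu + y i)) :
    pnorm z ≤ max (pnorm p) (pnorm y) := by
  refine pnorm_le_of_sub_le (k := Fin.last n) (by simp [hz, hp, hy, hlm]) fun i j => ?_
  rw [hz i, hz j, sub_le_iff_le_add]
  refine max_le ?_ ?_
  · linarith [sub_le_pnorm p i j, le_max_left (pnorm p) (pnorm y),
      le_max_left (lam + p j) (mu + y j)]
  · linarith [sub_le_pnorm y i j, le_max_right (pnorm p) (pnorm y),
      le_max_right (lam + p j) (mu + y j)]
end
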